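/- arXiv:math/0012035 — 3 statements merged into one kernel-verified Lean document; each statement's English description precedes it below -/
import Mathlib

section
/- For λ = (λ₁, …, λₙ) ∈ ℝⁿ, let X_λ ∈ sp(2n,ℝ) be the block matrix [[0, D], [-D, 0]] where D = diag(λ₁, …, λₙ) (this is the Hamiltonian matrix of the quadratic Hamiltonian Σⱼ (λⱼ/2)(qⱼ² + pⱼ²)). Then the centralizer {S ∈ Sp(2n,ℝ) : S X_λ = X_λ S} is compact if and only if λⱼ + λₖ ≠ 0 for all 1 ≤ j ≤ k ≤ n; that is, X_λ is strongly stable if and only if all the frequencies λⱼ are nonzero and any two with equal absolute values have the same sign. -/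
open Matrix

/-- The standard symplectic form matrix `Ω = [[0, Iₙ], [-Iₙ, 0]]` on `ℝ²ⁿ`
(coordinates indexed by `Fin n ⊕ Fin n`). -/
noncomputable def Omega (n : ℕ) : Matrix (Fin n ⊕ Fin n) (Fin n ⊕ Fin n) ℝ :=
  Matrix.fromBlocks 0 1 (-1) 0

/-- The real symplectic group `Sp(2n, ℝ) = {S : Sᵀ Ω S = Ω}`. -/
noncomputable def Sp (n : ℕ) : Set (Matrix (Fin n ⊕ Fin n) (Fin n ⊕ Fin n) ℝ) :=
  {S | Sᵀ * Omega n * S = Omega n}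

/-- The symplectic Lie algebra `sp(2n, ℝ) = {X : Xᵀ Ω + Ω X = 0}`. -/
noncomputable def sp (n : ℕ) : Set (Matrix (Fin n ⊕ Fin n) (Fin n ⊕ Fin n) ℝ) :=
  {X | Xᵀ * Omega n + Omega n * X = 0}

/-- A matrix commuting with `X_λ` commutes with `Ω` when no sum `λⱼ + λₖ` vanishes. -/
theorem commute_Omega_of_commute_diagonal_hamiltonian {n : ℕ} {lam : Fin n → ℝ}
    (h : ∀ j k, lam j + lam k ≠ 0) {S : Matrix (Fin n ⊕ Fin n) (Fin n ⊕ Fin n) ℝ}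
    (hS : S * fromBlocks 0 (diagonal lam) (-diagonal lam) 0 =
      fromBlocks 0 (diagonal lam) (-diagonal lam) 0 * S) :
    S * Omega n = Omega n * S := by
  obtain ⟨A, B, C, E, rfl⟩ : ∃ A B C E, S = fromBlocks A B C E :=
    ⟨_, _, _, _, (fromBlocks_toBlocks S).symm⟩
  simp only [Omega, fromBlocks_multiply, fromBlocks_inj] at hS ⊢
  simp only [Matrix.mul_zero, Matrix.zero_mul, zero_add, add_zero, Matrix.mul_neg, Matrix.neg_mul,
    Matrix.mul_one, Matrix.one_mul] at hS ⊢
  obtain ⟨h₁, h₂, h₃, h₄⟩ := hS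
  have hAE : A = E := by
    ext j k
    have e₂ := congrFun₂ h₂ j k
    have e₃ := congrFun₂ h₃ j k
    simp only [Matrix.neg_apply, mul_diagonal, diagonal_mul] at e₂ e₃
    exact mul_right_cancel₀ (h j k) (by linear_combination e₂ + e₃)
  have hBC : -B = C := by
    ext j k
    have e₁ := congrFun₂ h₁ j k
    have e₄ := congrFun₂ h₄ j k
    simp only [Matrix.neg_apply, mul_diagonal, diagonal_mul] at e₁ e₄ ⊢
    exact mul_right_cancel₀ (h j k) (by linear_combination e₁ - e₄)
  subst hAE hBC
  simp

/-- A symplectic matrix commuting with `Ω` is orthogonal. -/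
theorem transpose_mul_self_of_mem_Sp_of_commute {n : ℕ}
    {S : Matrix (Fin n ⊕ Fin n) (Fin n ⊕ Fin n) ℝ}
    (hS : S ∈ Sp n) (hc : S * Omega n = Omega n * S) : Sᵀ * S = 1 := by
  have hΩ : Omega n * -Omega n = 1 := by
    simp [Omega, fromBlocks_multiply, fromBlocks_neg, fromBlocks_one]
  have hS' : Sᵀ * Omega n * S = Omega n := hS
  calc Sᵀ * S = Sᵀ * (S * Omega n) * -Omega n := by
        rw [Matrix.mul_assoc, Matrix.mul_assoc, hΩ, Matrix.mul_one]
    _ = 1 := by rw [hc, ← Matrix.mul_assoc, hS', hΩ]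

theorem abs_apply_le_one_of_transpose_mul_self {m : Type*} [Fintype m] [DecidableEq m]
    {S : Matrix m m ℝ} (hS : Sᵀ * S = 1) (a b : m) : |S a b| ≤ 1 := by
  have hU : S ∈ unitaryGroup m ℝ := by
    rwa [mem_unitaryGroup_iff', star_eq_conjTranspose, conjTranspose_eq_transpose_of_trivial]
  exact entry_norm_bound_of_unitary hU a b

theorem isClosed_centralizer_Sp {n : ℕ} (X : Matrix (Fin n ⊕ Fin n) (Fin n ⊕ Fin n) ℝ) :
    IsClosed {S ∈ Sp n | S * X = X * S} := by
  have h₁ : IsClosed (Sp n) :=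
    isClosed_eq (((continuous_id.matrix_transpose).matrix_mul continuous_const).matrix_mul
      continuous_id) continuous_const
  have h₂ : IsClosed {S | S * X = X * S} :=
    isClosed_eq (continuous_id.matrix_mul continuous_const)
      (continuous_const.matrix_mul continuous_id)
  exact h₁.inter h₂

/-- The symmetric 0-1 matrix supported at the positions `(j, k)` and `(k, j)`. -/
def symmSingle {n : ℕ} (j k : Fin n) : Matrix (Fin n) (Fin n) ℝ :=
  of fun a b => if (a = j ∧ b = k) ∨ (a = k ∧ b = j) then 1 else 0

theorem symmSingle_transpose {n : ℕ} (j k : Fin n) : (symmSingle j k)ᵀ = symmSingle j k := by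
  ext a b
  simp only [symmSingle, transpose_apply, of_apply]
  congr 1
  grind

theorem symmSingle_mul_self {n : ℕ} (j k : Fin n) :
    symmSingle j k * symmSingle j k = diagonal fun a => if a = j ∨ a = k then 1 else 0 := by
  ext a b
  simp only [mul_apply, symmSingle, of_apply, diagonal_apply, mul_ite, mul_one, mul_zero,
    ← ite_and]
  rw [Finset.sum_eq_single (if a = j then k else j)] <;> grind

theorem symmSingle_mul_self_mul_self {n : ℕ} (j k : Fin n) :
    symmSingle j k * (symmSingle j k * symmSingle j k) = symmSingle j k := by
  ext a b
  rw [symmSingle_mul_self, mul_diagonal]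
  simp only [symmSingle, of_apply]
  grind

theorem symmSingle_mul_diagonal {n : ℕ} {lam : Fin n → ℝ} {j k : Fin n}
    (h : lam j + lam k = 0) :
    symmSingle j k * diagonal lam = -(diagonal lam * symmSingle j k) := by
  ext a b
  simp only [Matrix.neg_apply, mul_diagonal, diagonal_mul]
  simp only [symmSingle, of_apply]
  grind

/-- The hyperbolic rotation `exp (t M)` for `M = symmSingle j k`, with `s = sinh t`. -/
noncomputable def boost {n : ℕ} (j k : Fin n) (s : ℝ) : Matrix (Fin n) (Fin n) ℝ :=
  1 + s • symmSingle j k + (√(1 + s ^ 2) - 1) • (symmSingle j k * symmSingle j k)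

theorem boost_transpose {n : ℕ} (j k : Fin n) (s : ℝ) : (boost j k s)ᵀ = boost j k s := by
  simp [boost, symmSingle_transpose]

theorem boost_mul_boost_neg {n : ℕ} (j k : Fin n) (s : ℝ) :
    boost j k s * boost j k (-s) = 1 := by
  have hc : √(1 + s ^ 2) ^ 2 = 1 + s ^ 2 := Real.sq_sqrt (by positivity)
  have h₃ := symmSingle_mul_self_mul_self j k
  simp only [boost, neg_sq]
  generalize √(1 + s ^ 2) = c at hc ⊢
  generalize symmSingle j k = M at h₃ ⊢
  have h₃' : M * M * M = M := by rw [Matrix.mul_assoc, h₃]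
  have h₄ : M * M * (M * M) = M * M := by rw [← Matrix.mul_assoc, h₃']
  simp only [Matrix.mul_add, Matrix.add_mul, Matrix.mul_one, Matrix.one_mul, Matrix.smul_mul,
    Matrix.mul_smul, h₃, h₃', h₄]
  match_scalars <;> grind

theorem boost_mul_diagonal {n : ℕ} {lam : Fin n → ℝ} {j k : Fin n} (h : lam j + lam k = 0)
    (s : ℝ) : boost j k s * diagonal lam = diagonal lam * boost j k (-s) := by
  have hM := symmSingle_mul_diagonal h
  have hM₂ : symmSingle j k * symmSingle j k * diagonal lam =
      diagonal lam * (symmSingle j k * symmSingle j k) := by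
    rw [Matrix.mul_assoc, hM, Matrix.mul_neg, ← Matrix.mul_assoc, hM, Matrix.neg_mul, neg_neg,
      Matrix.mul_assoc]
  simp [boost, Matrix.mul_add, Matrix.add_mul, hM, hM₂]

theorem le_boost_apply {n : ℕ} (j k : Fin n) (s : ℝ) : s ≤ boost j k s j k := by
  have hc : 1 ≤ √(1 + s ^ 2) := Real.one_le_sqrt.2 (by nlinarith [sq_nonneg s])
  rw [boost, symmSingle_mul_self]
  by_cases hjk : j = k
  · subst hjk
    simp [symmSingle]
    linarith
  · simp [symmSingle, hjk]

theorem boost_mem_centralizer {n : ℕ} {lam : Fin n → ℝ} {j k : Fin n} (h : lam j + lam k = 0)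
    (s : ℝ) :
    fromBlocks (boost j k s) 0 0 (boost j k (-s)) ∈
      {S ∈ Sp n | S * fromBlocks 0 (diagonal lam) (-diagonal lam) 0 =
        fromBlocks 0 (diagonal lam) (-diagonal lam) 0 * S} := by
  have h₁ := boost_mul_boost_neg j k s
  have h₂ := boost_mul_boost_neg j k (-s)
  have h₃ := boost_mul_diagonal h s
  have h₄ := boost_mul_diagonal h (-s)
  rw [neg_neg] at h₂ h₄
  constructor
  · simp [Sp, Omega, fromBlocks_transpose, fromBlocks_multiply, boost_transpose, h₁, h₂]
  · simp only [fromBlocks_multiply, Matrix.mul_zero, Matrix.zero_mul, add_zero, zero_add,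
      Matrix.mul_neg, Matrix.neg_mul, neg_zero, h₃, h₄]

/-- The compact-Cartan element `X_λ = [[0, D], [-D, 0]]`,
`D = diag(λ₁, …, λₙ)`, is strongly stable (has compact centralizer in `Sp(2n,ℝ)`)
iff `λⱼ + λₖ ≠ 0` for all `j ≤ k`. -/
theorem diagonal_hamiltonian_stronglyStable_iff (n : ℕ) (lam : Fin n → ℝ)
    (X : Matrix (Fin n ⊕ Fin n) (Fin n ⊕ Fin n) ℝ)
    (hX : X = Matrix.fromBlocks 0 (Matrix.diagonal lam) (-(Matrix.diagonal lam)) 0) :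
    IsCompact {S ∈ Sp n | S * X = X * S} ↔
      ∀ j k : Fin n, j ≤ k → lam j + lam k ≠ 0 := by
  subst hX
  constructor
  · intro hK j k _ hjk
    have hcont : Continuous fun S : Matrix (Fin n ⊕ Fin n) (Fin n ⊕ Fin n) ℝ =>
        S (Sum.inl j) (Sum.inl k) := continuous_id.matrix_elem _ _
    obtain ⟨b, hb⟩ := (hK.image hcont).bddAbove
    have hle := hb (Set.mem_image_of_mem _ (boost_mem_centralizer hjk (b + 1)))
    simp only [fromBlocks_apply₁₁] at hle
    linarith [le_boost_apply j k (b + 1)]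
  · intro h
    have h' : ∀ j k, lam j + lam k ≠ 0 := fun j k =>
      (le_total j k).elim (h j k) fun hkj => add_comm (lam k) (lam j) ▸ h k j hkj
    have hbox : IsCompact (Set.univ.pi fun _ => Set.univ.pi fun _ => Set.Icc (-1) 1 :
        Set (Matrix (Fin n ⊕ Fin n) (Fin n ⊕ Fin n) ℝ)) :=
      isCompact_univ_pi fun _ => isCompact_univ_pi fun _ => isCompact_Icc
    refine hbox.of_isClosed_subset (isClosed_centralizer_Sp _) ?_
    rintro S ⟨hS, hc⟩ a - b -
    exact abs_le.1 (abs_apply_le_one_of_transpose_mul_self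
      (transpose_mul_self_of_mem_Sp_of_commute hS
        (commute_Omega_of_commute_diagonal_hamiltonian h' hc)) a b)
end

section
/- Let A be a symmetric positive definite 2n×2n real matrix. Then the stabilizer {S ∈ Sp(2n,ℝ) : SᵀAS = A} is compact; equivalently, the Hamiltonian matrix ΩA ∈ sp(2n,ℝ) is strongly stable. In particular, every positive-definite quadratic Hamiltonian on ℝ^{2n} is strongly stable. -/
open Matrix

/-- The columns of `M` have Euclidean norms prescribed by the diagonal of `Mᵀ * M`. -/
theorem isCompact_setOf_transpose_mul_self_eq {ι : Type*} [Fintype ι] (A : Matrix ι ι ℝ) :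
    IsCompact {M : Matrix ι ι ℝ | Mᵀ * M = A} := by
  have hK : IsCompact (Set.univ.pi fun _ : ι => Set.univ.pi fun j : ι =>
      Set.Icc (-√(A j j)) (√(A j j))) :=
    isCompact_univ_pi fun _ => isCompact_univ_pi fun _ => isCompact_Icc
  refine hK.of_isClosed_subset (isClosed_eq (by fun_prop) continuous_const) ?_
  rintro (M : Matrix ι ι ℝ) rfl i - j -
  refine abs_le.mp (Real.abs_le_sqrt ?_)
  simp only [mul_apply, transpose_apply, ← sq]
  exact Finset.single_le_sum (f := fun k => M k j ^ 2) (fun k _ => sq_nonneg _) (Finset.mem_univ i)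

open scoped MatrixOrder Matrix.Norms.L2Operator in
/-- A positive definite real matrix is the Gram matrix of an invertible matrix. -/
theorem Matrix.PosDef.exists_isUnit_eq_transpose_mul_self {ι : Type*} [Fintype ι]
    [DecidableEq ι] {A : Matrix ι ι ℝ} (hA : A.PosDef) :
    ∃ B : Matrix ι ι ℝ, IsUnit B ∧ A = Bᵀ * B := by
  obtain ⟨B, hB⟩ := CStarAlgebra.nonneg_iff_eq_star_mul_self.mp hA.posSemidef.nonneg
  exact ⟨B, isUnit_of_mul_isUnit_right (hB ▸ hA.isUnit),
    by simpa [star_eq_conjTranspose] using hB⟩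

/-- The group of linear isometries of a positive definite quadratic form is compact. -/
theorem Matrix.PosDef.isCompact_setOf_transpose_mul_mul_eq {ι : Type*} [Fintype ι]
    [DecidableEq ι] {A : Matrix ι ι ℝ} (hA : A.PosDef) :
    IsCompact {S : Matrix ι ι ℝ | Sᵀ * A * S = A} := by
  obtain ⟨B, hB, hAB⟩ := hA.exists_isUnit_eq_transpose_mul_self
  refine ((isCompact_setOf_transpose_mul_self_eq A).image
    (f := fun M => B⁻¹ * M) (by fun_prop)).of_isClosed_subset
    (isClosed_eq (by fun_prop) continuous_const) ?_
  intro S (hS : Sᵀ * A * S = A)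
  refine ⟨B * S, ?_, ?_⟩
  · change (B * S)ᵀ * (B * S) = A
    rw [← hS, hAB, transpose_mul]
    simp only [Matrix.mul_assoc]
  · exact nonsing_inv_mul_cancel_left _ _ ((isUnit_iff_isUnit_det B).mp hB)

theorem Omega_transpose (n : ℕ) : (Omega n)ᵀ = -Omega n := by
  simp [Omega, fromBlocks_transpose, fromBlocks_neg]

theorem Omega_mul_self (n : ℕ) : Omega n * Omega n = -1 := by
  simp [Omega, fromBlocks_multiply, ← fromBlocks_one, fromBlocks_neg]

theorem isClosed_Sp (n : ℕ) : IsClosed (Sp n) :=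
  isClosed_eq (by fun_prop) continuous_const

/-- A Hamiltonian matrix `Ω * A` with `A` symmetric lies in the symplectic Lie algebra. -/
theorem Omega_mul_mem_sp {n : ℕ} {A : Matrix (Fin n ⊕ Fin n) (Fin n ⊕ Fin n) ℝ}
    (hA : A.IsSymm) : Omega n * A ∈ sp n := by
  rw [sp, Set.mem_ofPred_eq, transpose_mul, hA.eq, Omega_transpose, ← Matrix.mul_assoc,
    Omega_mul_self, Matrix.mul_assoc, Matrix.neg_mul, Omega_mul_self]
  simp

/-- A symplectic matrix commutes with `Ω * A` exactly when it preserves the form `A`. -/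
theorem commutes_Omega_mul_iff {n : ℕ} {S : Matrix (Fin n ⊕ Fin n) (Fin n ⊕ Fin n) ℝ}
    (hS : S ∈ Sp n) (A : Matrix (Fin n ⊕ Fin n) (Fin n ⊕ Fin n) ℝ) :
    S * (Omega n * A) = (Omega n * A) * S ↔ Sᵀ * A * S = A := by
  have hS' : Sᵀ * Omega n * S = Omega n := hS
  have hinv : (Sᵀ * Omega n) * (S * -Omega n) = 1 := by
    rw [← Matrix.mul_assoc, hS', Matrix.mul_neg, Omega_mul_self, neg_neg]
  have hinj : Function.Injective fun X => (Sᵀ * Omega n) * X :=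
    Function.LeftInverse.injective (g := fun X => (S * -Omega n) * X) fun X => by
      change S * -Omega n * (Sᵀ * Omega n * X) = X
      rw [← Matrix.mul_assoc (S * -Omega n), mul_eq_one_comm.mp hinv, Matrix.one_mul]
  have hl : (Sᵀ * Omega n) * (S * (Omega n * A)) = -A := by
    rw [← Matrix.mul_assoc, hS', ← Matrix.mul_assoc, Omega_mul_self, Matrix.neg_mul,
      Matrix.one_mul]
  have hr : (Sᵀ * Omega n) * (Omega n * A * S) = -(Sᵀ * A * S) := by
    rw [Matrix.mul_assoc, Matrix.mul_assoc (Omega n), ← Matrix.mul_assoc (Omega n) (Omega n),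
      Omega_mul_self, Matrix.neg_mul, Matrix.one_mul, Matrix.mul_neg, Matrix.mul_assoc]
  rw [← hinj.eq_iff, hl, hr, neg_inj, eq_comm]

/-- For a symmetric positive definite `A`, the stabilizer
`{S ∈ Sp(2n,ℝ) : Sᵀ A S = A}` is compact; equivalently, the Hamiltonian matrix
`Ω A` lies in `sp(2n,ℝ)` and is strongly stable (has compact centralizer). -/
theorem posDef_hamiltonian_stronglyStable (n : ℕ)
    (A : Matrix (Fin n ⊕ Fin n) (Fin n ⊕ Fin n) ℝ) (hA : A.PosDef) :
    IsCompact {S ∈ Sp n | Sᵀ * A * S = A} ∧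
      Omega n * A ∈ sp n ∧
      IsCompact {S ∈ Sp n | S * (Omega n * A) = (Omega n * A) * S} := by
  have hstab : IsCompact {S ∈ Sp n | Sᵀ * A * S = A} :=
    hA.isCompact_setOf_transpose_mul_mul_eq.inter_left (isClosed_Sp n)
  refine ⟨hstab, Omega_mul_mem_sp (by simpa [IsHermitian, IsSymm] using hA.isHermitian), ?_⟩
  convert hstab using 1
  ext S
  exact and_congr_right fun hS => commutes_Omega_mul_iff hS A
end

section
/- Let A and B be symmetric positive definite 2n×2n real matrices, and let O_A = {SᵀAS : S ∈ Sp(2n,ℝ)} and O_B = {SᵀBS : S ∈ Sp(2n,ℝ)}, with the subspace topology from the space of symmetric 2n×2n matrices. Then the addition map O_A × O_B → PD(2n), (P, Q) ↦ P + Q, is a proper map into the set PD(2n) of symmetric positive definite 2n×2n matrices (with its subspace topology); that is, the preimage of any compact subset of PD(2n) is compact. -/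
open Matrix

open scoped MatrixOrder in
/-- The sublevel sets of `S ↦ tr (Sᵀ A S)` are compact when `A` is positive definite. -/
theorem Matrix.PosDef.isCompact_setOf_trace_conj_le {m : Type*} [Fintype m] [DecidableEq m]
    {A : Matrix m m ℝ} (hA : A.PosDef) (b : ℝ) :
    IsCompact {S : Matrix m m ℝ | (Sᵀ * A * S).trace ≤ b} := by
  obtain ⟨M, hM, rfl⟩ :=
    CStarAlgebra.isStrictlyPositive_iff_eq_star_mul_self.mp hA.isStrictlyPositive
  have hbox : IsCompact {X : Matrix m m ℝ | ∀ i j, X i j ∈ Set.Icc (-√b) (√b)} := by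
    have h : IsCompact {X : m → m → ℝ | ∀ i j, X i j ∈ Set.Icc (-√b) (√b)} := by
      convert isCompact_univ_pi fun _ : m ↦ isCompact_univ_pi fun _ : m ↦
        isCompact_Icc (a := -√b) (b := √b) using 1
      ext X
      simp only [Set.mem_pi, Set.mem_univ, forall_const, Set.mem_ofPred_eq]
    exact h
  refine (hbox.image (f := fun X ↦ M⁻¹ * X) (by fun_prop)).of_isClosed_subset
    (isClosed_le (by fun_prop) continuous_const) fun S hS ↦ ⟨M * S, fun i j ↦ ?_, ?_⟩
  · have htr : (Sᵀ * (star M * M) * S).trace = ∑ j, ∑ i, (M * S) i j ^ 2 := by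
      rw [star_eq_conjTranspose, conjTranspose_eq_transpose_of_trivial, ← Matrix.mul_assoc, ← transpose_mul,
        Matrix.mul_assoc]
      simp only [trace, diag_apply, mul_apply (M := (M * S)ᵀ), transpose_apply, sq]
    rw [Set.mem_ofPred_eq, htr] at hS
    refine abs_le.mp (Real.abs_le_sqrt (le_trans ?_ hS))
    calc (M * S) i j ^ 2 ≤ ∑ i, (M * S) i j ^ 2 :=
          Finset.single_le_sum (f := fun i ↦ (M * S) i j ^ 2) (fun _ _ ↦ sq_nonneg _)
            (Finset.mem_univ i)
      _ ≤ _ := Finset.single_le_sum (f := fun j ↦ ∑ i, (M * S) i j ^ 2)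
            (fun _ _ ↦ Finset.sum_nonneg fun _ _ ↦ sq_nonneg _) (Finset.mem_univ j)
  · exact Matrix.nonsing_inv_mul_cancel_left _ _ ((Matrix.isUnit_iff_isUnit_det _).mp hM)

theorem Matrix.PosDef.trace_conj_nonneg {m : Type*} [Fintype m]
    {A : Matrix m m ℝ} (hA : A.PosDef) (S : Matrix m m ℝ) : 0 ≤ (Sᵀ * A * S).trace := by
  rw [← conjTranspose_eq_transpose_of_trivial]
  exact (hA.posSemidef.conjTranspose_mul_mul_same S).trace_nonneg

/-- Let `A`, `B` be symmetric positive definite and let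
`O_A = {Sᵀ A S : S ∈ Sp(2n,ℝ)}`, `O_B = {Sᵀ B S : S ∈ Sp(2n,ℝ)}` be their symplectic
orbits.  The addition map `O_A × O_B → PD(2n)`, `(P, Q) ↦ P + Q`, is proper: the
preimage of any compact set of positive definite matrices is compact. -/
theorem addition_map_proper_on_posDef_orbits (n : ℕ)
    (A B : Matrix (Fin n ⊕ Fin n) (Fin n ⊕ Fin n) ℝ) (hA : A.PosDef) (hB : B.PosDef) :
    ∀ K : Set (Matrix (Fin n ⊕ Fin n) (Fin n ⊕ Fin n) ℝ),
      (∀ P ∈ K, P.PosDef) → IsCompact K →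
      IsCompact {p : Matrix (Fin n ⊕ Fin n) (Fin n ⊕ Fin n) ℝ ×
                     Matrix (Fin n ⊕ Fin n) (Fin n ⊕ Fin n) ℝ |
        (∃ S ∈ Sp n, p.1 = Sᵀ * A * S) ∧ (∃ S ∈ Sp n, p.2 = Sᵀ * B * S) ∧
          p.1 + p.2 ∈ K} := by
  intro K _ hK
  obtain ⟨b, hb⟩ := (hK.image (f := Matrix.trace) (by fun_prop)).bddAbove
  have hcompact : IsCompact {p : Matrix (Fin n ⊕ Fin n) (Fin n ⊕ Fin n) ℝ ×
      Matrix (Fin n ⊕ Fin n) (Fin n ⊕ Fin n) ℝ |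
      p.1 ∈ Sp n ∧ p.2 ∈ Sp n ∧ p.1ᵀ * A * p.1 + p.2ᵀ * B * p.2 ∈ K} := by
    refine ((hA.isCompact_setOf_trace_conj_le b).prod
      (hB.isCompact_setOf_trace_conj_le b)).of_isClosed_subset ?_ ?_
    · exact ((isClosed_Sp n).preimage continuous_fst).inter
        (((isClosed_Sp n).preimage continuous_snd).inter (hK.isClosed.preimage (by fun_prop)))
    · rintro ⟨S, T⟩ ⟨-, -, h⟩
      have hle := hb (Set.mem_image_of_mem _ h)
      rw [trace_add] at hle
      have hS := hA.trace_conj_nonneg S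
      have hT := hB.trace_conj_nonneg T
      exact ⟨by dsimp at *; linarith, by dsimp at *; linarith⟩
  convert hcompact.image (f := fun p ↦ (p.1ᵀ * A * p.1, p.2ᵀ * B * p.2)) (by fun_prop) using 1
  ext ⟨P, Q⟩
  constructor
  · rintro ⟨⟨S, hS, rfl⟩, ⟨T, hT, rfl⟩, h⟩
    exact ⟨(S, T), ⟨hS, hT, h⟩, rfl⟩
  · rintro ⟨⟨S, T⟩, ⟨hS, hT, h⟩, heq⟩
    obtain ⟨rfl, rfl⟩ := Prod.mk.inj heq
    exact ⟨⟨S, hS, rfl⟩, ⟨T, hT, rfl⟩, h⟩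
end
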